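/- arXiv:2502.09928 — 3 statements merged into one kernel-verified Lean document; each statement's English description precedes it below -/
import Mathlib

section
/- Let L D : ℕ and for each l ∈ Fin L let A₁ˡ, A₂ˡ, Bˡ : Matrix (Fin D) (Fin D) ℝ. Define gₗ : (Fin D → ℝ) → (Fin D → ℝ) by gₗ x = Bˡ.mulVec ((A₁ˡ.mulVec x) * (A₂ˡ.mulVec x)), and let F be the composition g_{L-1} ∘ ⋯ ∘ g₀. Then for every τ : Fin D there exists p ∈ MvPolynomial (Fin D) ℝ homogeneous of degree 2^L such that for every x : Fin D → ℝ, MvPolynomial.eval x p = F x τ. -/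
/-- Every coordinate of `f` is given by a homogeneous polynomial of degree `d`. -/
def IsHomogeneousPolynomialMap {σ ι R : Type*} [CommSemiring R] (d : ℕ)
    (f : (σ → R) → ι → R) : Prop :=
  ∀ i, ∃ p : MvPolynomial σ R, p.IsHomogeneous d ∧ ∀ x, MvPolynomial.eval x p = f x i

namespace IsHomogeneousPolynomialMap

variable {σ ι κ R : Type*} [CommSemiring R] {d e : ℕ}

theorem id : IsHomogeneousPolynomialMap 1 (id : (σ → R) → σ → R) := fun i =>
  ⟨MvPolynomial.X i, MvPolynomial.isHomogeneous_X R i, fun _ => MvPolynomial.eval_X i⟩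

theorem mul {f g : (σ → R) → ι → R} (hf : IsHomogeneousPolynomialMap d f)
    (hg : IsHomogeneousPolynomialMap e g) :
    IsHomogeneousPolynomialMap (d + e) fun x => f x * g x := fun i => by
  obtain ⟨p, hp, hpf⟩ := hf i
  obtain ⟨q, hq, hqg⟩ := hg i
  exact ⟨p * q, hp.mul hq, fun x => by rw [map_mul, hpf, hqg]; rfl⟩

theorem mulVec [Fintype ι] {f : (σ → R) → ι → R} (hf : IsHomogeneousPolynomialMap d f)
    (A : Matrix κ ι R) : IsHomogeneousPolynomialMap d fun x => A.mulVec (f x) := fun k => by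
  choose p hp hpf using hf
  refine ⟨∑ i, MvPolynomial.C (A k i) * p i,
    MvPolynomial.IsHomogeneous.sum _ _ _ fun i _ => (hp i).C_mul _, fun x => ?_⟩
  simp [hpf, Matrix.mulVec, dotProduct]

theorem foldl_comp {l : List ((ι → R) → ι → R)}
    (hl : ∀ g ∈ l, ∀ (d : ℕ) (f : (σ → R) → ι → R), IsHomogeneousPolynomialMap d f →
      IsHomogeneousPolynomialMap (e * d) (g ∘ f))
    {f : (σ → R) → ι → R} (hf : IsHomogeneousPolynomialMap d f) :
    IsHomogeneousPolynomialMap (e ^ l.length * d) (l.foldl (fun acc g => g ∘ acc) f) := by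
  induction l generalizing d f with
  | nil => simpa using hf
  | cons g l ih =>
    rw [List.length_cons, pow_succ, mul_assoc]
    exact ih (fun g' hg' => hl g' (List.mem_cons_of_mem g hg')) (hl g List.mem_cons_self d f hf)

end IsHomogeneousPolynomialMap

theorem dttn_no_shortcut_homogeneous_pow_two (L D : ℕ)
    (A₁ A₂ B : Fin L → Matrix (Fin D) (Fin D) ℝ)
    (g : Fin L → (Fin D → ℝ) → (Fin D → ℝ))
    (hg : ∀ l x, g l x = (B l).mulVec (((A₁ l).mulVec x) * ((A₂ l).mulVec x)))
    (F : (Fin D → ℝ) → (Fin D → ℝ))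
    (hF : F = (List.ofFn g).foldl (fun acc gl => gl ∘ acc) id)
    (τ : Fin D) :
    ∃ p : MvPolynomial (Fin D) ℝ, p.IsHomogeneous (2 ^ L) ∧
      ∀ x : Fin D → ℝ, MvPolynomial.eval x p = F x τ := by
  have h_layer : ∀ h ∈ List.ofFn g, ∀ (d : ℕ) (f : (Fin D → ℝ) → Fin D → ℝ),
      IsHomogeneousPolynomialMap d f → IsHomogeneousPolynomialMap (2 * d) (h ∘ f) := by
    intro h hh d f hf
    obtain ⟨l, rfl⟩ := List.mem_ofFn.mp hh
    rw [two_mul, show g l ∘ f = _ from funext fun x => hg l (f x)]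
    exact ((hf.mulVec (A₁ l)).mul (hf.mulVec (A₂ l))).mulVec (B l)
  have h_fold := IsHomogeneousPolynomialMap.foldl_comp h_layer IsHomogeneousPolynomialMap.id
  rw [List.length_ofFn, mul_one, ← hF] at h_fold
  exact h_fold τ
end

section
/- Let L D : ℕ and for each l ∈ Fin L let A₁ˡ, A₂ˡ, Bˡ : Matrix (Fin D) (Fin D) ℝ. Define fₗ : (Fin D → ℝ) → (Fin D → ℝ) by fₗ x = x + Bˡ.mulVec ((A₁ˡ.mulVec x) * (A₂ˡ.mulVec x)), and let F be the composition f_{L-1} ∘ ⋯ ∘ f₀. Then for every τ : Fin D there exists p ∈ MvPolynomial (Fin D) ℝ with totalDegree p ≤ 2^L such that for every x : Fin D → ℝ, MvPolynomial.eval x p = F x τ. -/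
/-- The map `g` is given coordinatewise by polynomials of total degree at most `d`. -/
def IsPolynomialMapOfDegreeLE {σ ι R : Type*} [CommSemiring R] (d : ℕ)
    (g : (σ → R) → ι → R) : Prop :=
  ∀ i, ∃ p : MvPolynomial σ R, p.totalDegree ≤ d ∧ ∀ x, MvPolynomial.eval x p = g x i

namespace IsPolynomialMapOfDegreeLE

open MvPolynomial

variable {σ ι κ R : Type*} [CommSemiring R] {d e : ℕ} {g h : (σ → R) → ι → R}

theorem id : IsPolynomialMapOfDegreeLE 1 (id : (σ → R) → σ → R) := fun i =>
  ⟨X i, (totalDegree_monomial_le _ _).trans (by simp), fun x => by simp⟩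

theorem mono (hg : IsPolynomialMapOfDegreeLE d g) (hde : d ≤ e) :
    IsPolynomialMapOfDegreeLE e g := fun i =>
  let ⟨p, hp, hpg⟩ := hg i
  ⟨p, hp.trans hde, hpg⟩

theorem add (hg : IsPolynomialMapOfDegreeLE d g) (hh : IsPolynomialMapOfDegreeLE d h) :
    IsPolynomialMapOfDegreeLE d (fun x => g x + h x) := fun i =>
  let ⟨p, hp, hpg⟩ := hg i
  let ⟨q, hq, hqh⟩ := hh i
  ⟨p + q, (totalDegree_add p q).trans (max_le hp hq), fun x => by simp [hpg, hqh]⟩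

theorem mul (hg : IsPolynomialMapOfDegreeLE d g) (hh : IsPolynomialMapOfDegreeLE e h) :
    IsPolynomialMapOfDegreeLE (d + e) (fun x => g x * h x) := fun i =>
  let ⟨p, hp, hpg⟩ := hg i
  let ⟨q, hq, hqh⟩ := hh i
  ⟨p * q, (totalDegree_mul p q).trans (add_le_add hp hq), fun x => by simp [hpg, hqh]⟩

theorem mulVec [Fintype ι] (M : Matrix κ ι R) (hg : IsPolynomialMapOfDegreeLE d g) :
    IsPolynomialMapOfDegreeLE d (fun x => M.mulVec (g x)) := by
  intro k
  choose p hp hpg using hg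
  refine ⟨∑ i, C (M k i) * p i, totalDegree_finsetSum_le fun i _ => ?_, fun x => ?_⟩
  · exact (totalDegree_mul _ _).trans (by simpa using hp i)
  · simp [hpg, Matrix.mulVec, dotProduct]

/-- Applying an antisymmetric interacting module doubles the degree bound. -/
theorem add_mulVec_mul [Fintype ι] [Fintype κ] (A₁ A₂ : Matrix κ ι R) (B : Matrix ι κ R)
    (hg : IsPolynomialMapOfDegreeLE d g) :
    IsPolynomialMapOfDegreeLE (d * 2)
      (fun x => g x + B.mulVec (A₁.mulVec (g x) * A₂.mulVec (g x))) :=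
  (hg.mono (by lia)).add ((((hg.mulVec A₁).mul (hg.mulVec A₂)).mulVec B).mono (by lia))

theorem foldl_comp {l : List ((ι → R) → ι → R)}
    (hl : ∀ f ∈ l, ∀ (d : ℕ) (g : (σ → R) → ι → R), IsPolynomialMapOfDegreeLE d g →
      IsPolynomialMapOfDegreeLE (d * 2) (f ∘ g))
    (hg : IsPolynomialMapOfDegreeLE d g) :
    IsPolynomialMapOfDegreeLE (d * 2 ^ l.length) (l.foldl (fun acc f => f ∘ acc) g) := by
  induction l generalizing d g with
  | nil => simpa using hg
  | cons f l ih =>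
    rw [List.length_cons, pow_succ', ← mul_assoc]
    exact ih (fun f' hf' => hl f' (List.mem_cons_of_mem f hf')) (hl f List.mem_cons_self d g hg)

end IsPolynomialMapOfDegreeLE

theorem dttn_totalDegree_le_pow_two (L D : ℕ)
    (A₁ A₂ B : Fin L → Matrix (Fin D) (Fin D) ℝ)
    (f : Fin L → (Fin D → ℝ) → (Fin D → ℝ))
    (hf : ∀ l x, f l x = x + (B l).mulVec (((A₁ l).mulVec x) * ((A₂ l).mulVec x)))
    (F : (Fin D → ℝ) → (Fin D → ℝ))
    (hF : F = (List.ofFn f).foldl (fun acc fl => fl ∘ acc) id)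
    (τ : Fin D) :
    ∃ p : MvPolynomial (Fin D) ℝ, p.totalDegree ≤ 2 ^ L ∧
      ∀ x : Fin D → ℝ, MvPolynomial.eval x p = F x τ := by
  have hlayer : ∀ fl ∈ List.ofFn f, ∀ (d : ℕ) (g : (Fin D → ℝ) → Fin D → ℝ),
      IsPolynomialMapOfDegreeLE d g → IsPolynomialMapOfDegreeLE (d * 2) (fl ∘ g) := by
    intro fl hfl d g hg
    obtain ⟨l, rfl⟩ := List.mem_ofFn.mp hfl
    simpa only [Function.comp_def, hf] using hg.add_mulVec_mul (A₁ l) (A₂ l) (B l)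
  subst hF
  simpa using IsPolynomialMapOfDegreeLE.id.foldl_comp hlayer τ
end

section
/- Let N d : ℕ with d ≥ 1 and let T : (Fin N → Fin d) → ℝ be any real-valued tensor with N indices each ranging over Fin d. Then there exist a bond dimension r : ℕ, cores G : Fin N → Fin d → Matrix (Fin r) (Fin r) ℝ, and boundary vectors u v : Fin r → ℝ such that for every k : Fin N → Fin d, T k = u ⬝ᵥ ((∏_{i=0}^{N-1} G i (k i)).mulVec v), where the product of matrices is taken in the order i = 0, 1, …, N−1. -/
open Matrix

theorem list_prod_ofFn_diagonal {n R : Type*} [Fintype n] [DecidableEq n] [CommSemiring R]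
    {N : ℕ} (f : Fin N → n → R) :
    (List.ofFn fun i => diagonal (f i)).prod = diagonal (∏ i, f i) := by
  have h := map_list_prod (Matrix.diagonalRingHom n R) (List.ofFn f)
  rw [List.map_ofFn, List.prod_ofFn] at h
  exact h.symm

theorem exists_mps_representation (N d : ℕ) (hd : 1 ≤ d)
    (T : (Fin N → Fin d) → ℝ) :
    ∃ (r : ℕ) (G : Fin N → Fin d → Matrix (Fin r) (Fin r) ℝ)
      (u v : Fin r → ℝ),
      ∀ k : Fin N → Fin d,
        T k = u ⬝ᵥ ((List.ofFn (fun i : Fin N => G i (k i))).prod).mulVec v := by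
  let e := Fintype.equivFin (Fin N → Fin d)
  refine ⟨_, fun i j => diagonal fun a => if e.symm a i = j then 1 else 0,
    fun a => T (e.symm a), 1, fun k => ?_⟩
  have hprod (s : Fin N → Fin d) :
      (∏ i, if s i = k i then (1 : ℝ) else 0) = if s = k then 1 else 0 := by
    simp [Finset.prod_ite_zero, funext_iff]
  rw [list_prod_ofFn_diagonal]
  simp only [dotProduct, mulVec_diagonal, Finset.prod_apply, hprod, Pi.one_apply, mul_one]
  rw [e.symm.sum_comp fun s => T s * if s = k then 1 else 0]
  simp
end
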